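/- For an algebraic curvature tensor R in dimension n ≥ 4 satisfying the first Bianchi identity, with decomposition R = ω₂ + gω₁ + g²ω₀ into Weyl, traceless-Ricci and scalar parts, if n = 2p then the double Hodge star acts by *(g^{p−2}R) = g^{p−2}ω₂ − g^{p−1}ω₁ + g^p ω₀; more generally for ω = Σ_{i=0}^p g^{p−i}ω_i ∈ C₁^p with ω_i effective, *ω = Σ_{i=0}^p (−1)^i g^{p−i} ω_i. -/

import Mathlib

open Finset

noncomputable section

/-- Double forms on the Euclidean space `ℝⁿ`: elements of `Λᵖ(ℝⁿ)* ⊗ Λ^q(ℝⁿ)*`,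
represented by their (antisymmetric) coefficient arrays in the standard
orthonormal basis. -/
abbrev DForm (n p q : ℕ) := (Fin p → Fin n) → (Fin q → Fin n) → ℝ

/-- Transport of a double form along equalities of the bidegree. -/
def castD {n p q p' q' : ℕ} (hp : p = p') (hq : q = q') (ω : DForm n p q) :
    DForm n p' q' :=
  fun x y => ω (x ∘ Fin.cast hp) (y ∘ Fin.cast hq)

/-- The product in the ring of double forms: the exterior product taken
simultaneously on both factors. -/
def dmul {n p q r s : ℕ} (ω : DForm n p q) (η : DForm n r s) :
    DForm n (p + r) (q + s) :=
  fun x y =>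
    (1 / ((p.factorial * r.factorial * q.factorial * s.factorial : ℕ) : ℝ)) *
      ∑ σ : Equiv.Perm (Fin (p + r)), ∑ τ : Equiv.Perm (Fin (q + s)),
        ((Equiv.Perm.sign σ : ℤ) : ℝ) * ((Equiv.Perm.sign τ : ℤ) : ℝ) *
          (ω (fun i => x (σ (Fin.castAdd r i))) (fun j => y (τ (Fin.castAdd s j))) *
           η (fun i => x (σ (Fin.natAdd p i))) (fun j => y (τ (Fin.natAdd q j))))

/-- The metric `g` of `ℝⁿ` as a double form of bidegree `(1,1)` (the identity
element of the contraction: the Kronecker delta). -/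
def gform (n : ℕ) : DForm n 1 1 := fun x y => if x 0 = y 0 then 1 else 0

/-- Powers `g^k` of the metric in the ring of double forms. -/
def gpow (n : ℕ) : (k : ℕ) → DForm n k k
  | 0 => fun _ _ => 1
  | k + 1 => castD (Nat.add_comm 1 k) (Nat.add_comm 1 k) (dmul (gform n) (gpow n k))

/-- The contraction map `c : D^{p+1,q+1} → D^{p,q}`. -/
def contr {n p q : ℕ} (ω : DForm n (p + 1) (q + 1)) : DForm n p q :=
  fun x y => ∑ j : Fin n, ω (Fin.cons j x) (Fin.cons j y)

/-- The natural inner product on `D^{p,q}` (for which the increasing basis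
monomials are orthonormal). -/
def dinner {n p q : ℕ} (ω₁ ω₂ : DForm n p q) : ℝ :=
  (1 / ((p.factorial * q.factorial : ℕ) : ℝ)) *
    ∑ x : Fin p → Fin n, ∑ y : Fin q → Fin n, ω₁ x y * ω₂ x y

/-- A coefficient array represents a double form iff it is antisymmetric in each
group of arguments. -/
def IsAlt {n p q : ℕ} (ω : DForm n p q) : Prop :=
  (∀ (σ : Equiv.Perm (Fin p)) (x : Fin p → Fin n) (y : Fin q → Fin n),
      ω (x ∘ σ) y = ((Equiv.Perm.sign σ : ℤ) : ℝ) * ω x y) ∧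
  (∀ (τ : Equiv.Perm (Fin q)) (x : Fin p → Fin n) (y : Fin q → Fin n),
      ω x (y ∘ τ) = ((Equiv.Perm.sign τ : ℤ) : ℝ) * ω x y)

/-- A double form in `D^{p,p}` is symmetric if it is invariant under exchanging
the two factors. -/
def IsSym {n p : ℕ} (ω : DForm n p p) : Prop := ∀ x y, ω x y = ω y x

/-- The first Bianchi map sends `D^{p,q+1}` to `D^{p+1,q}`; a double form satisfies
the first Bianchi identity when it lies in its kernel. -/
def FirstBianchi {n p q : ℕ} (ω : DForm n p (q + 1)) : Prop :=
  ∀ (x : Fin (p + 1) → Fin n) (y : Fin q → Fin n),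
    ∑ k : Fin (p + 1),
      (-1 : ℝ) ^ (k : ℕ) * ω (x ∘ Fin.succAbove k) (Fin.cons (x k) y) = 0

/-- The sign of a family `(f i)` of indices: the signature of `f` viewed as a
permutation if it is bijective, and `0` otherwise (Levi-Civita symbol). -/
def eps {n : ℕ} (f : Fin n → Fin n) : ℝ :=
  if h : Function.Bijective f then
    ((Equiv.Perm.sign (Equiv.ofBijective f h) : ℤ) : ℝ)
  else 0

/-- The Hodge star operator on double forms, acting as the usual Hodge star
simultaneously on both factors. -/
def dstar {n p q : ℕ} (hp : p ≤ n) (hq : q ≤ n) (ω : DForm n p q) :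
    DForm n (n - p) (n - q) :=
  fun x y =>
    (1 / ((p.factorial * q.factorial : ℕ) : ℝ)) *
      ∑ u : Fin p → Fin n, ∑ v : Fin q → Fin n,
        eps (fun i => Fin.append u x (Fin.cast (by omega) i)) *
        eps (fun i => Fin.append v y (Fin.cast (by omega) i)) * ω u v

section StarDecomposition

open Equiv
open Equiv.Perm (sign)

section PermutationSums

/-- The sign of a permutation as a real number. -/
abbrev rsign {N : ℕ} (σ : Perm (Fin N)) : ℝ := ((sign σ : ℤ) : ℝ)

theorem rsign_mul {N : ℕ} (σ τ : Perm (Fin N)) : rsign (σ * τ) = rsign σ * rsign τ := by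
  simp [rsign]

theorem rsign_mul_self {N : ℕ} (σ : Perm (Fin N)) : rsign σ * rsign σ = 1 := by
  rw [← Int.cast_mul, Int.units_coe_mul_self, Int.cast_one]

/-- The permutation of `Fin (a + b)` acting by `α` on the first block and by `β` on the second. -/
def blockPerm {a b : ℕ} (α : Perm (Fin a)) (β : Perm (Fin b)) : Perm (Fin (a + b)) :=
  finSumFinEquiv.permCongr (Perm.sumCongr α β)

@[simp] theorem blockPerm_castAdd {a b : ℕ} (α : Perm (Fin a)) (β : Perm (Fin b)) (j : Fin a) :
    blockPerm α β (Fin.castAdd b j) = Fin.castAdd b (α j) := by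
  simp [blockPerm, Equiv.permCongr_apply]

@[simp] theorem blockPerm_natAdd {a b : ℕ} (α : Perm (Fin a)) (β : Perm (Fin b)) (j : Fin b) :
    blockPerm α β (Fin.natAdd a j) = Fin.natAdd a (β j) := by
  simp [blockPerm, Equiv.permCongr_apply]

theorem rsign_blockPerm {a b : ℕ} (α : Perm (Fin a)) (β : Perm (Fin b)) :
    rsign (blockPerm α β) = rsign α * rsign β := by
  simp [rsign, blockPerm]

theorem sum_rsign_mul_sum {N k : ℕ} (j : Perm (Fin k) → Perm (Fin N))
    (hj : ∀ α, rsign (j α) = rsign α) (K : Perm (Fin N) → ℝ) :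
    ∑ σ, rsign σ * ∑ α, rsign α * K (σ * j α) = k.factorial * ∑ σ, rsign σ * K σ := by
  simp_rw [Finset.mul_sum]
  rw [Finset.sum_comm]
  have h : ∀ α : Perm (Fin k), ∑ σ, rsign σ * (rsign α * K (σ * j α)) = ∑ σ, rsign σ * K σ := by
    intro α
    rw [← Equiv.sum_comp (Equiv.mulRight (j α)) (fun σ => rsign σ * K σ)]
    refine Finset.sum_congr rfl fun σ _ => ?_
    simp only [Equiv.coe_mulRight, rsign_mul, hj]
    ring
  rw [Finset.sum_congr rfl fun α _ => h α]
  simp [Fintype.card_perm, Finset.mul_sum]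

theorem sum_sum_rsign_mul_sum_sum {N k : ℕ} (j : Perm (Fin k) → Perm (Fin N))
    (hj : ∀ α, rsign (j α) = rsign α) (K : Perm (Fin N) → Perm (Fin N) → ℝ) :
    ∑ σ, ∑ τ, rsign σ * rsign τ * ∑ α, ∑ β, rsign α * rsign β * K (σ * j α) (τ * j β) =
      (k.factorial * k.factorial : ℝ) * ∑ σ, ∑ τ, rsign σ * rsign τ * K σ τ := by
  have h1 : ∀ σ α : Perm _, ∑ τ, rsign τ * ∑ β, rsign β * K (σ * j α) (τ * j β) =
      k.factorial * ∑ τ, rsign τ * K (σ * j α) τ :=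
    fun σ α => sum_rsign_mul_sum j hj fun τ => K (σ * j α) τ
  calc _ = ∑ σ, rsign σ * ∑ α, rsign α *
        ∑ τ, rsign τ * ∑ β, rsign β * K (σ * j α) (τ * j β) := by
        refine Finset.sum_congr rfl fun σ _ => ?_
        simp_rw [Finset.mul_sum]
        rw [Finset.sum_comm]
        refine Finset.sum_congr rfl fun α _ => Finset.sum_congr rfl fun τ _ =>
          Finset.sum_congr rfl fun β _ => by ring
    _ = ∑ σ, rsign σ * ∑ α, rsign α * (k.factorial * ∑ τ, rsign τ * K (σ * j α) τ) := by
        simp_rw [h1]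
    _ = _ := by
        rw [sum_rsign_mul_sum j hj fun σ => k.factorial * ∑ τ, rsign τ * K σ τ]
        simp_rw [Finset.mul_sum]
        refine Finset.sum_congr rfl fun σ _ => Finset.sum_congr rfl fun τ _ => by ring

end PermutationSums

section MetricPowers

/-- The antisymmetrized product of Kronecker deltas, which is `N!` times the Gram determinant. -/
def deltaForm (n N : ℕ) : DForm n N N := fun x y =>
  ∑ σ : Perm (Fin N), ∑ τ : Perm (Fin N),
    rsign σ * rsign τ * ∏ k, if x (σ k) = y (τ k) then (1 : ℝ) else 0

theorem castD_deltaForm {n N N' : ℕ} (h : N = N') :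
    castD h h (deltaForm n N) = deltaForm n N' := by
  subst h; rfl

theorem dmul_gform_deltaForm (n k : ℕ) :
    dmul (gform n) (deltaForm n k) = deltaForm n (1 + k) := by
  ext x y
  have h := sum_sum_rsign_mul_sum_sum (N := 1 + k) (blockPerm (1 : Perm (Fin 1)))
    (fun α => by rw [rsign_blockPerm]; simp [rsign])
    (fun σ τ => ∏ k, if x (σ k) = y (τ k) then (1 : ℝ) else 0)
  have hk : (k.factorial : ℝ) ≠ 0 := by positivity
  have h' : dmul (gform n) (deltaForm n k) x y =
      1 / (k.factorial * k.factorial : ℝ) * (∑ σ, ∑ τ, rsign σ * rsign τ *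
        ∑ α, ∑ β, rsign α * rsign β *
          ∏ j, if x ((σ * blockPerm (1 : Perm (Fin 1)) α : Perm (Fin (1 + k))) j) =
            y ((τ * blockPerm (1 : Perm (Fin 1)) β : Perm (Fin (1 + k))) j) then (1 : ℝ) else 0) := by
    simp only [dmul, gform, deltaForm, Nat.factorial_one, one_mul, mul_one, Nat.cast_mul]
    congr 1
    refine Finset.sum_congr rfl fun σ _ => Finset.sum_congr rfl fun τ _ => ?_
    congr 1
    simp_rw [Finset.mul_sum]
    refine Finset.sum_congr rfl fun α _ => Finset.sum_congr rfl fun β _ => ?_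
    rw [Fin.prod_univ_add]
    simp only [Perm.mul_apply, blockPerm_castAdd, blockPerm_natAdd, Fin.prod_univ_one,
      Perm.one_apply]
    ring
  rw [h', h, deltaForm]
  field_simp

theorem gpow_eq_deltaForm (n k : ℕ) : gpow n k = deltaForm n k := by
  induction k with
  | zero =>
    ext x y
    simp [gpow, deltaForm, rsign]
  | succ k ih => rw [gpow, ih, dmul_gform_deltaForm, castD_deltaForm]

theorem dmul_gpow_apply {n m i : ℕ} (ω : DForm n i i) (x y : Fin (m + i) → Fin n) :
    dmul (gpow n m) ω x y =
      1 / (i.factorial * i.factorial : ℝ) * ∑ σ : Perm (Fin (m + i)), ∑ τ : Perm (Fin (m + i)),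
        rsign σ * rsign τ *
          ((∏ k : Fin m, if x (σ (Fin.castAdd i k)) = y (τ (Fin.castAdd i k)) then (1 : ℝ) else 0) *
            ω (fun j => x (σ (Fin.natAdd m j))) (fun j => y (τ (Fin.natAdd m j)))) := by
  have h := sum_sum_rsign_mul_sum_sum (N := m + i)
    (fun α => blockPerm α (1 : Perm (Fin i)))
    (fun α => by rw [rsign_blockPerm]; simp [rsign])
    (fun σ τ => (∏ k : Fin m,
      if x (σ (Fin.castAdd i k)) = y (τ (Fin.castAdd i k)) then (1 : ℝ) else 0) *
        ω (fun j => x (σ (Fin.natAdd m j))) (fun j => y (τ (Fin.natAdd m j))))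
  have hm : (m.factorial : ℝ) ≠ 0 := by positivity
  have hi : (i.factorial : ℝ) ≠ 0 := by positivity
  simp only [Perm.mul_apply, blockPerm_castAdd, blockPerm_natAdd, Perm.one_apply] at h
  have h' : dmul (gpow n m) ω x y =
      1 / (m.factorial * i.factorial * m.factorial * i.factorial : ℝ) *
        (∑ σ : Perm (Fin (m + i)), ∑ τ : Perm (Fin (m + i)), rsign σ * rsign τ *
        ∑ α : Perm (Fin m), ∑ β : Perm (Fin m), rsign α * rsign β *
          ((∏ k : Fin m,
            if x (σ (Fin.castAdd i (α k))) = y (τ (Fin.castAdd i (β k))) then (1 : ℝ) else 0) *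
            ω (fun j => x (σ (Fin.natAdd m j))) (fun j => y (τ (Fin.natAdd m j))))) := by
    rw [gpow_eq_deltaForm]
    simp only [dmul, deltaForm, Nat.cast_mul]
    congr 1
    refine Finset.sum_congr rfl fun σ _ => Finset.sum_congr rfl fun τ _ => ?_
    congr 1
    simp_rw [Finset.sum_mul]
    refine Finset.sum_congr rfl fun α _ => Finset.sum_congr rfl fun β _ => ?_
    ring
  rw [h', h]
  field_simp

end MetricPowers

section Alternating

variable {n : ℕ}

theorem IsAlt.apply_left_eq_zero {p q : ℕ} {ω : DForm n p q} (h : IsAlt ω) {x : Fin p → Fin n}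
    (y : Fin q → Fin n) {a b : Fin p} (hab : a ≠ b) (hx : x a = x b) : ω x y = 0 := by
  have h1 := h.1 (Equiv.swap a b) x y
  have h2 : x ∘ Equiv.swap a b = x := by
    ext j
    simp only [Function.comp_apply, Equiv.swap_apply_def]
    split_ifs with h h' <;> simp_all
  rw [h2, Perm.sign_swap hab] at h1
  simp at h1
  linarith

theorem IsAlt.apply_right_eq_zero {p q : ℕ} {ω : DForm n p q} (h : IsAlt ω) (x : Fin p → Fin n)
    {y : Fin q → Fin n} {a b : Fin q} (hab : a ≠ b) (hy : y a = y b) : ω x y = 0 :=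
  IsAlt.apply_left_eq_zero (ω := fun y x => ω x y)
    ⟨fun σ x y => h.2 σ y x, fun σ x y => h.1 σ y x⟩ x hab hy

theorem IsAlt.comp_comp {p : ℕ} {ω : DForm n p p} (h : IsAlt ω) (x y : Fin p → Fin n)
    (τ : Perm (Fin p)) : ω (x ∘ τ) (y ∘ τ) = ω x y := by
  rw [h.1, h.2, ← mul_assoc, rsign_mul_self, one_mul]

theorem isAlt_dmul {p q r s : ℕ} (ω : DForm n p q) (η : DForm n r s) : IsAlt (dmul ω η) := by
  constructor
  · intro ρ x y
    simp only [dmul]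
    rw [mul_left_comm]
    congr 1
    rw [← Equiv.sum_comp (Equiv.mulLeft ρ) (fun σ : Perm (Fin (p + r)) =>
      ∑ τ : Perm (Fin (q + s)), rsign σ * rsign τ *
        (ω (fun i => x (σ (Fin.castAdd r i))) (fun j => y (τ (Fin.castAdd s j))) *
          η (fun i => x (σ (Fin.natAdd p i))) (fun j => y (τ (Fin.natAdd q j))))),
      Finset.mul_sum]
    refine Finset.sum_congr rfl fun σ _ => ?_
    rw [Finset.mul_sum]
    refine Finset.sum_congr rfl fun τ _ => ?_
    simp only [Equiv.coe_mulLeft, Perm.mul_apply, Function.comp_apply, rsign_mul]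
    linear_combination (-rsign σ * rsign τ *
      (ω (fun i => x (ρ (σ (Fin.castAdd r i)))) (fun j => y (τ (Fin.castAdd s j))) *
        η (fun i => x (ρ (σ (Fin.natAdd p i)))) (fun j => y (τ (Fin.natAdd q j))))) *
      rsign_mul_self ρ
  · intro ρ x y
    simp only [dmul]
    rw [mul_left_comm]
    congr 1
    rw [Finset.mul_sum]
    refine Finset.sum_congr rfl fun σ _ => ?_
    rw [← Equiv.sum_comp (Equiv.mulLeft ρ) (fun τ : Perm (Fin (q + s)) =>
      rsign σ * rsign τ *
        (ω (fun i => x (σ (Fin.castAdd r i))) (fun j => y (τ (Fin.castAdd s j))) *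
          η (fun i => x (σ (Fin.natAdd p i))) (fun j => y (τ (Fin.natAdd q j))))),
      Finset.mul_sum]
    refine Finset.sum_congr rfl fun τ _ => ?_
    simp only [Equiv.coe_mulLeft, Perm.mul_apply, Function.comp_apply, rsign_mul]
    linear_combination (-rsign σ * rsign τ *
      (ω (fun i => x (σ (Fin.castAdd r i))) (fun j => y (ρ (τ (Fin.castAdd s j)))) *
        η (fun i => x (σ (Fin.natAdd p i))) (fun j => y (ρ (τ (Fin.natAdd q j)))))) *
      rsign_mul_self ρ

/-- Contracting an effective form in an arbitrary pair of equal positions gives zero. -/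
theorem sum_update_eq_zero {i : ℕ} {ω : DForm n (i + 1) (i + 1)} (h : IsAlt ω) (hc : contr ω = 0)
    (X Y : Fin (i + 1) → Fin n) (q : Fin (i + 1)) :
    ∑ j, ω (Function.update X q j) (Function.update Y q j) = 0 := by
  have h1 := congrFun (congrFun hc (fun k => X (Equiv.swap 0 q k.succ)))
    (fun k => Y (Equiv.swap 0 q k.succ))
  have h2 : ∀ (X : Fin (i + 1) → Fin n) (j : Fin n),
      (Fin.cons j fun k : Fin i => X (Equiv.swap 0 q k.succ) : Fin (i + 1) → Fin n) =
        Function.update X q j ∘ Equiv.swap 0 q := by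
    intro X j
    ext k
    refine Fin.cases ?_ (fun k => ?_) k
    · simp
    · have : Equiv.swap 0 q k.succ ≠ q := by
        intro h
        rw [Equiv.swap_apply_eq_iff, Equiv.swap_apply_right] at h
        exact Fin.succ_ne_zero _ h
      simp [Function.update_of_ne this]
  simp only [contr, h2, h.comp_comp, Pi.zero_apply] at h1
  exact h1

end Alternating

section Reindexing

theorem exists_perm_extend {α : Type*} [Fintype α] [DecidableEq α] {s : Set α} {f : α → α}
    (hf : Set.InjOn f s) : ∃ g : Perm α, ∀ a ∈ s, g a = f a := by
  obtain ⟨g, hg⟩ := Set.MapsTo.exists_equiv_extend_of_card_eq (t := Finset.univ) (s := s) (f := f)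
    (by simp) (fun _ _ => by simp) hf
  exact ⟨g.trans (Equiv.subtypeUnivEquiv Finset.mem_univ), hg⟩

theorem exists_perm_comp_eq {ι α : Type*} [Fintype α] [DecidableEq α] {s l : ι → α}
    (hs : Function.Injective s) (hl : Function.Injective l) : ∃ g : Perm α, ⇑g ∘ s = l := by
  obtain ⟨g, hg⟩ := exists_perm_extend (s := Set.range s) (f := Function.extend s l id) (by
    rintro _ ⟨a, rfl⟩ _ ⟨b, rfl⟩ h
    rw [hs.extend_apply, hs.extend_apply] at h
    rw [hl h])
  refine ⟨g, funext fun a => ?_⟩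
  rw [Function.comp_apply, hg _ ⟨a, rfl⟩, hs.extend_apply]

theorem exists_eq_blockPerm_one {m i : ℕ} (τ : Perm (Fin (m + i)))
    (hτ : ∀ k, τ (Fin.castAdd i k) = Fin.castAdd i k) :
    ∃ ρ : Perm (Fin i), τ = blockPerm 1 ρ := by
  have h : finSumFinEquiv.symm.permCongr τ ∈ (Perm.sumCongrHom (Fin m) (Fin i)).range := by
    apply Perm.mem_sumCongrHom_range_of_perm_mapsTo_inl
    rintro _ ⟨k, rfl⟩
    exact ⟨k, by simp [Equiv.permCongr_apply, hτ]⟩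
  obtain ⟨⟨α, β⟩, h⟩ := h
  have h' : τ = blockPerm α β := by
    have h1 : Perm.sumCongr α β = finSumFinEquiv.symm.permCongr τ := h
    rw [blockPerm, h1]
    ext j
    simp [Equiv.permCongr_apply]
  refine ⟨β, ?_⟩
  ext j
  refine Fin.addCases (fun k => ?_) (fun k => ?_) j
  · simp [hτ]
  · simp [h']

/-- The first block of positions is sent into `S`. -/
abbrev HeadIn {m i : ℕ} (S : Finset (Fin (m + i))) (σ : Perm (Fin (m + i))) : Prop :=
  ∀ k : Fin m, σ (Fin.castAdd i k) ∈ S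

/-- `l` takes values in `S` where `s` does, and agrees with `s` elsewhere. -/
abbrev AgreesOff {i p : ℕ} (S : Finset (Fin p)) (s l : Fin i → Fin p) : Prop :=
  ∀ q, (s q ∈ S → l q ∈ S) ∧ (s q ∉ S → l q = s q)

theorem HeadIn.mem_range {m i : ℕ} {S : Finset (Fin (m + i))} {σ : Perm (Fin (m + i))}
    (h : HeadIn S σ) {j : Fin (m + i)} (hj : j ∉ S) : ∃ q, σ (Fin.natAdd m q) = j := by
  obtain ⟨k, rfl⟩ := σ.surjective j
  induction k using Fin.addCases with
  | left k => exact absurd (h k) hj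
  | right k => exact ⟨k, rfl⟩

theorem perm_mem_iff {p : ℕ} {S : Finset (Fin p)} {π : Perm (Fin p)} (h : ∀ j ∉ S, π j = j)
    (j : Fin p) : π j ∈ S ↔ j ∈ S := by
  constructor
  · intro h1
    by_contra h2
    rw [h j h2] at h1
    exact h2 h1
  · intro h1
    by_contra h2
    have := π.injective (h _ h2)
    rw [this] at h2
    exact h2 h1

theorem AgreesOff.exists_perm {i p : ℕ} {S : Finset (Fin p)} {s l : Fin i → Fin p}
    (hl : AgreesOff S s l) (hs : Function.Injective s) (hli : Function.Injective l)
    (hS : ∀ j ∉ S, ∃ q, s q = j) :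
    ∃ π : Perm (Fin p), (∀ j ∉ S, π j = j) ∧ ⇑π ∘ s = l := by
  obtain ⟨π, hπ⟩ := exists_perm_comp_eq hs hli
  refine ⟨π, fun j hj => ?_, hπ⟩
  obtain ⟨q, rfl⟩ := hS j hj
  exact (congrFun hπ q).trans ((hl q).2 hj)

theorem exists_agreesOff_comp {i p : ℕ} {S : Finset (Fin p)} {s f : Fin i → Fin p}
    (hs : Function.Injective s) (hf : Function.Injective f)
    (hsS : ∀ j ∉ S, ∃ q, s q = j) (hfS : ∀ j ∉ S, ∃ q, f q = j) :
    ∃ τ : Perm (Fin i), AgreesOff S s (f ∘ τ) := by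
  have h : ∀ q, ∃ q', s q ∉ S → f q' = s q := by
    intro q
    by_cases hq : s q ∈ S
    · exact ⟨q, fun h => absurd hq h⟩
    · obtain ⟨q', h⟩ := hfS _ hq
      exact ⟨q', fun _ => h⟩
  choose g hg using h
  obtain ⟨τ, hτ⟩ := exists_perm_extend (s := {q | s q ∉ S}) (f := g) (by
    intro a ha b hb hab
    apply hs
    rw [← hg a ha, ← hg b hb, hab])
  have hτ' : ∀ q, s q ∉ S → f (τ q) = s q := fun q hq => by rw [hτ q hq, hg q hq]
  refine ⟨τ, fun q => ⟨fun hq => ?_, hτ' q⟩⟩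
  by_contra hq'
  obtain ⟨r, hr⟩ := hsS _ hq'
  have hrS : s r ∉ S := by rw [hr]; exact hq'
  have := τ.injective (hf ((hτ' r hrS).trans hr))
  exact hrS (this ▸ hq)

open Classical in
/-- Sums over permutations sending the head into `S`, of a symmetric function of the tail, are
proportional to sums over tuples, with a factor that does not depend on the function. -/
theorem sum_headIn_eq_sum_agreesOff {m i : ℕ} {S : Finset (Fin (m + i))} {s : Fin i → Fin (m + i)}
    (hs : Function.Injective s) (hsS : ∀ j ∉ S, ∃ q, s q = j) :
    ∃ c d : ℝ, c ≠ 0 ∧ ∀ h : (Fin i → Fin (m + i)) → ℝ,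
      (∀ f (τ : Perm (Fin i)), h (f ∘ τ) = h f) → (∀ f, ¬ Function.Injective f → h f = 0) →
      c * ∑ σ : Perm (Fin (m + i)), (if HeadIn S σ then h (fun q => σ (Fin.natAdd m q)) else 0) =
        d * ∑ l, if AgreesOff S s l then h l else 0 := by
  set Γ : Finset (Perm (Fin (m + i))) := Finset.univ.filter fun π => ∀ j ∉ S, π j = j with hΓ
  have hΓm : ∀ π, π ∈ Γ ↔ ∀ j ∉ S, π j = j := by simp [hΓ]
  have hΓ0 : (Γ.card : ℝ) ≠ 0 := by
    rw [Nat.cast_ne_zero, Finset.card_ne_zero]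
    exact ⟨1, by simp [hΓm]⟩
  let c : ℝ := ∑ l : Fin i → Fin (m + i), if AgreesOff S s l ∧ Function.Injective l then 1 else 0
  let d : ℝ := ∑ σ : Perm (Fin (m + i)), if HeadIn S σ then 1 else 0
  have hc : 0 < c := by
    refine Finset.sum_pos' (fun l _ => by split_ifs <;> norm_num) ⟨s, Finset.mem_univ _, ?_⟩
    rw [if_pos ⟨fun q => ⟨id, fun _ => rfl⟩, hs⟩]
    exact one_pos
  refine ⟨c, d, hc.ne', fun h hperm hinj => ?_⟩
  let E : (Fin i → Fin (m + i)) → ℝ := fun f => ∑ π, if π ∈ Γ then h (π ∘ f) else 0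
  have hE : ∀ (π₀ : Perm _) f, π₀ ∈ Γ → E (π₀ ∘ f) = E f := by
    intro π₀ f hπ₀
    simp only [E]
    rw [← Equiv.sum_comp (Equiv.mulRight π₀) (fun π => if π ∈ Γ then h (π ∘ f) else 0)]
    refine Finset.sum_congr rfl fun π _ => ?_
    have : π * π₀ ∈ Γ ↔ π ∈ Γ := by
      rw [hΓm, hΓm]
      refine forall₂_congr fun j hj => ?_
      rw [Perm.mul_apply, (hΓm _).1 hπ₀ j hj]
    simp only [Equiv.coe_mulRight, this]
    rfl
  have hEτ : ∀ f (τ : Perm (Fin i)), E (f ∘ τ) = E f := by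
    intro f τ
    simp only [E, ← Function.comp_assoc, hperm]
  have hEs : ∀ l, AgreesOff S s l → Function.Injective l → E l = E s := by
    intro l hl hli
    obtain ⟨π, h1, rfl⟩ := hl.exists_perm hs hli hsS
    exact hE _ _ ((hΓm _).2 h1)
  have hA : (Γ.card : ℝ) * ∑ σ : Perm (Fin (m + i)),
      (if HeadIn S σ then h (fun q => σ (Fin.natAdd m q)) else 0) = d * E s := by
    have h1 : ∀ π ∈ Γ, ∑ σ : Perm (Fin (m + i)),
        (if HeadIn S σ then h (fun q => σ (Fin.natAdd m q)) else 0) =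
        ∑ σ : Perm (Fin (m + i)),
          (if HeadIn S σ then h (π ∘ fun q => σ (Fin.natAdd m q)) else 0) := by
      intro π hπ
      rw [← Equiv.sum_comp (Equiv.mulLeft π)]
      refine Finset.sum_congr rfl fun σ _ => ?_
      simp only [HeadIn, Equiv.coe_mulLeft, Perm.mul_apply, perm_mem_iff ((hΓm π).1 hπ)]
      rfl
    rw [← nsmul_eq_mul, ← Finset.sum_const, Finset.sum_congr rfl h1, Finset.sum_comm,
      Finset.sum_mul]
    refine Finset.sum_congr rfl fun σ _ => ?_
    by_cases hσ : HeadIn S σ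
    · have hi : Function.Injective fun q => σ (Fin.natAdd m q) :=
        σ.injective.comp (Fin.natAdd_injective i m)
      obtain ⟨τ, hτ⟩ := exists_agreesOff_comp hs hi hsS fun j hj => hσ.mem_range hj
      simp only [if_pos hσ, one_mul]
      rw [← hEs _ hτ (hi.comp τ.injective), hEτ]
      simp only [E, Finset.sum_ite_mem, Finset.univ_inter]
    · simp [if_neg hσ]
  have hB : (Γ.card : ℝ) * ∑ l, (if AgreesOff S s l then h l else 0) = c * E s := by
    have h1 : ∀ π ∈ Γ, ∑ l, (if AgreesOff S s l then h l else 0) =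
        ∑ l, (if AgreesOff S s l then h (π ∘ l) else 0) := by
      intro π hπ
      rw [← Equiv.sum_comp (Equiv.arrowCongr (Equiv.refl (Fin i)) π)]
      refine Finset.sum_congr rfl fun l _ => ?_
      have h2 : (Equiv.arrowCongr (Equiv.refl (Fin i)) π) l = π ∘ l := by ext; simp
      have h3 : AgreesOff S s (π ∘ l) ↔ AgreesOff S s l := by
        have hπ' := (hΓm π).1 hπ
        refine forall_congr' fun q => and_congr ?_ (forall_congr' fun hq => ?_)
        · simp only [Function.comp_apply, perm_mem_iff hπ']
        · conv_lhs => rw [← hπ' _ hq, Function.comp_apply, π.injective.eq_iff]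
      rw [h2]
      simp only [h3]
    rw [← nsmul_eq_mul, ← Finset.sum_const, Finset.sum_congr rfl h1, Finset.sum_comm,
      Finset.sum_mul]
    refine Finset.sum_congr rfl fun l _ => ?_
    by_cases hl : AgreesOff S s l
    · by_cases hli : Function.Injective l
      · rw [if_pos (And.intro hl hli), one_mul, ← hEs l hl hli]
        simp only [if_pos hl, E, Finset.sum_ite_mem, Finset.univ_inter]
      · simp only [if_pos hl, hli, and_false, if_false, zero_mul]
        refine Finset.sum_eq_zero fun π _ => hinj _ fun h => hli (h.of_comp)
    · rw [if_neg fun h => hl h.1]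
      simp only [if_neg hl, Finset.sum_const_zero, zero_mul]
  apply mul_left_cancel₀ hΓ0
  rw [mul_left_comm, hA, mul_left_comm (Γ.card : ℝ), hB]
  ring

theorem sum_eq_zero_of_sum_update {ι α : Type*} [Fintype ι] [DecidableEq ι] [Fintype α]
    [DecidableEq α] [Nonempty α] (W : (ι → α) → ℝ) (q : ι)
    (h : ∀ l, ∑ a, W (Function.update l q a) = 0) : ∑ l, W l = 0 := by
  rw [← Equiv.sum_comp (Equiv.funSplitAt q α).symm, Fintype.sum_prod_type_right]
  refine Finset.sum_eq_zero fun r _ => ?_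
  rw [← h ((Equiv.funSplitAt q α).symm (Classical.arbitrary α, r))]
  refine Finset.sum_congr rfl fun a _ => congrArg W (funext fun k => ?_)
  by_cases hk : k = q
  · subst hk; simp [Equiv.funSplitAt]
  · simp [Equiv.funSplitAt, hk]

end Reindexing

section MiddleDegree

variable {n : ℕ}

open Classical in
/-- When the entries of `x` and `y` coincide exactly at the positions in `S`, the product
`g ^ m * ω` only involves pairs of equal permutations. -/
theorem exists_dmul_gpow_apply_eq {m i : ℕ} {ω : DForm n i i} (hω : IsAlt ω) :
    ∃ κ : ℝ, ∀ (S : Finset (Fin (m + i))) (x y : Fin (m + i) → Fin n),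
      (∀ j l, x j = y l ↔ j = l ∧ j ∈ S) →
      dmul (gpow n m) ω x y = κ * ∑ σ : Perm (Fin (m + i)), if HeadIn S σ then
        ω (x ∘ fun q => σ (Fin.natAdd m q)) (y ∘ fun q => σ (Fin.natAdd m q)) else 0 := by
  refine ⟨1 / (i.factorial * i.factorial : ℝ) * ∑ τ : Perm (Fin (m + i)),
    if ∀ k, τ (Fin.castAdd i k) = Fin.castAdd i k then 1 else 0, fun S x y hxy => ?_⟩
  rw [dmul_gpow_apply, mul_assoc]
  congr 1
  rw [mul_comm, Finset.sum_mul]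
  refine Finset.sum_congr rfl fun σ _ => ?_
  rw [← Equiv.sum_comp (Equiv.mulLeft σ), Finset.mul_sum]
  refine Finset.sum_congr rfl fun τ _ => ?_
  simp only [Equiv.coe_mulLeft, Perm.mul_apply, hxy, σ.injective.eq_iff]
  by_cases hσ : HeadIn S σ
  · by_cases hτ : ∀ k, τ (Fin.castAdd i k) = Fin.castAdd i k
    · rw [if_pos hσ, if_pos hτ]
      rw [Finset.prod_congr rfl fun k _ => if_pos ⟨(hτ k).symm, hσ k⟩]
      obtain ⟨ρ, rfl⟩ := exists_eq_blockPerm_one τ hτ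
      have h1 : (fun j => y (σ (blockPerm 1 ρ (Fin.natAdd m j)))) =
          (y ∘ fun q => σ (Fin.natAdd m q)) ∘ ρ := by ext; simp
      have h2 : rsign (1 : Perm (Fin m)) = 1 := by simp [rsign]
      rw [h1, hω.2, rsign_mul, rsign_blockPerm, h2]
      have h3 := rsign_mul_self ρ
      have h4 := rsign_mul_self σ
      simp only [Finset.prod_const_one, one_mul, mul_one]
      change rsign σ * (rsign σ * rsign ρ) *
        (rsign ρ * ω (x ∘ fun q => σ (Fin.natAdd m q)) (y ∘ fun q => σ (Fin.natAdd m q))) = _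
      linear_combination ω (x ∘ fun q => σ (Fin.natAdd m q)) (y ∘ fun q => σ (Fin.natAdd m q)) *
        (rsign ρ * rsign ρ * h4 + h3)
    · rw [if_neg hτ, mul_zero]
      push Not at hτ
      obtain ⟨k, hk⟩ := hτ
      rw [Finset.prod_eq_zero (Finset.mem_univ k) (if_neg fun h => hk h.1.symm)]
      ring
  · rw [if_neg hσ, zero_mul]
    simp only [HeadIn, not_forall] at hσ
    obtain ⟨k, hk⟩ := hσ
    rw [Finset.prod_eq_zero (Finset.mem_univ k) (if_neg fun h => hk h.2)]
    ring

/-- Index tuples `u, x` exhausting `Fin n`, with `x, y` agreeing on `S`, `u, v` agreeing on `S`,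
and `v = x`, `u = y` off `S`. -/
structure Complementary {p : ℕ} (S : Finset (Fin p)) (u v x y : Fin p → Fin n) : Prop where
  bijective : Function.Bijective (Sum.elim u x)
  right : ∀ j, y j = if j ∈ S then x j else u j
  left : ∀ j, v j = if j ∈ S then u j else x j

theorem Complementary.eq_iff {p : ℕ} {S : Finset (Fin p)} {u v x y : Fin p → Fin n}
    (h : Complementary S u v x y) (j l : Fin p) : x j = y l ↔ j = l ∧ j ∈ S := by
  have hi := h.bijective.injective
  rw [h.right]
  split_ifs with hl
  · have : x j = x l ↔ j = l := by
      simpa using hi.eq_iff (a := Sum.inr j) (b := Sum.inr l)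
    rw [this]
    exact ⟨fun e => ⟨e, e ▸ hl⟩, fun e => e.1⟩
  · have : x j ≠ u l := by
      simpa using hi.ne (a₁ := Sum.inr j) (a₂ := Sum.inl l) (by simp)
    exact ⟨fun e => absurd e this, fun e => absurd (e.1 ▸ e.2) hl⟩

theorem Complementary.symm {p : ℕ} {S : Finset (Fin p)} {u v x y : Fin p → Fin n}
    (h : Complementary S u v x y) : Complementary S x y u v :=
  ⟨by
    rw [← Sum.elim_swap]
    exact h.bijective.comp (Equiv.sumComm (Fin p) (Fin p)).bijective, h.left, h.right⟩

theorem Complementary.sum_eq {p : ℕ} {S : Finset (Fin p)} {u v x y : Fin p → Fin n}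
    (h : Complementary S u v x y) (f : Fin n → ℝ) : ∑ a, f a = ∑ j, (f (u j) + f (x j)) := by
  rw [← Equiv.sum_comp (Equiv.ofBijective _ h.bijective), Fintype.sum_sum_type,
    Finset.sum_add_distrib]
  rfl

open Classical in
/-- Each traced position with values in `S` contributes a sign when the common values of `x, y`
are traded for those of `u, v`. -/
theorem sum_agreesOff_eq {i p : ℕ} {ω : DForm n i i} (hω : IsAlt ω)
    (hc : ∀ (X Y : Fin i → Fin n) (q : Fin i),
      ∑ a, ω (Function.update X q a) (Function.update Y q a) = 0)
    {S : Finset (Fin p)} {u v x y : Fin p → Fin n} (h : Complementary S u v x y)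
    {s : Fin i → Fin p} (hsS : ∀ j ∉ S, ∃ q, s q = j) :
    ∑ l, (if AgreesOff S s l then ω (x ∘ l) (y ∘ l) else 0) =
      (∏ q, if s q ∈ S then -1 else 1) *
        ∑ l, if AgreesOff S s l then ω (v ∘ l) (u ∘ l) else 0 := by
  let X : Finset (Fin i) → (Fin i → Fin p) → Fin i → Fin n :=
    fun T l q => if q ∈ T then v (l q) else x (l q)
  let Y : Finset (Fin i) → (Fin i → Fin p) → Fin i → Fin n :=
    fun T l q => if q ∈ T then u (l q) else y (l q)
  let M : Finset (Fin i) → ℝ :=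
    fun T => ∑ l, if AgreesOff S s l then ω (X T l) (Y T l) else 0
  have hX : ∀ T l q, X T l q = if q ∈ T then v (l q) else x (l q) := fun _ _ _ => rfl
  have hY : ∀ T l q, Y T l q = if q ∈ T then u (l q) else y (l q) := fun _ _ _ => rfl
  have step : ∀ q T, q ∉ T → M T = (if s q ∈ S then -1 else 1) * M (insert q T) := by
    intro q T hqT
    by_cases hq : s q ∈ S
    · suffices M T + M (insert q T) = 0 by rw [if_pos hq]; linarith
      simp only [M]
      rw [← Finset.sum_add_distrib]
      have : Nonempty (Fin p) := ⟨s q⟩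
      refine sum_eq_zero_of_sum_update _ q fun l => ?_
      by_cases hl : ∀ r, r ≠ q → (s r ∈ S → l r ∈ S) ∧ (s r ∉ S → l r = s r)
      · have hagree : ∀ j, AgreesOff S s (Function.update l q j) ↔ j ∈ S := by
          intro j
          constructor
          · intro h
            simpa using (h q).1 hq
          · intro hj r
            by_cases hr : r = q
            · subst hr; simp [hj, hq]
            · simpa [hr] using hl r hr
        refine Eq.trans ?_ (hc (X T l) (Y T l) q)
        rw [h.sum_eq]
        refine Finset.sum_congr rfl fun j _ => ?_
        simp only [hagree]
        by_cases hj : j ∈ S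
        · have e1 : X T (Function.update l q j) = Function.update (X T l) q (x j) := by
            ext1 r
            by_cases hr : r = q
            · subst hr; simp [hX, hqT]
            · simp [hX, hr]
          have e2 : Y T (Function.update l q j) = Function.update (Y T l) q (x j) := by
            ext1 r
            by_cases hr : r = q
            · subst hr; simp [hY, hqT, h.right, hj]
            · simp [hY, hr]
          have e3 : X (insert q T) (Function.update l q j) = Function.update (X T l) q (u j) := by
            ext1 r
            by_cases hr : r = q
            · subst hr; simp [hX, h.left, hj]
            · simp [hX, hr]
          have e4 : Y (insert q T) (Function.update l q j) = Function.update (Y T l) q (u j) := by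
            ext1 r
            by_cases hr : r = q
            · subst hr; simp [hY]
            · simp [hY, hr]
          rw [if_pos hj, if_pos hj, e1, e2, e3, e4, add_comm]
        · obtain ⟨r, rfl⟩ := hsS j hj
          have hr : r ≠ q := fun e => hj (e ▸ hq)
          have hlr : l r = s r := (hl r hr).2 hj
          have e1 : Function.update (X T l) q (x (s r)) r =
              Function.update (X T l) q (x (s r)) q := by
            simp [hr, hX, hlr, h.left, hj]
          have e2 : Function.update (Y T l) q (u (s r)) r =
              Function.update (Y T l) q (u (s r)) q := by
            simp [hr, hY, hlr, h.right, hj]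
          rw [if_neg hj, if_neg hj, hω.apply_left_eq_zero _ hr e1, hω.apply_right_eq_zero _ hr e2]
      · have hagree : ∀ j, ¬ AgreesOff S s (Function.update l q j) := by
          intro j h
          refine hl fun r hr => ?_
          simpa [hr] using h r
        simp [hagree]
    · rw [if_neg hq, one_mul]
      refine Finset.sum_congr rfl fun l _ => ?_
      by_cases hl : AgreesOff S s l
      · rw [if_pos hl, if_pos hl]
        have hlq := (hl q).2 hq
        congr 1 <;> ext1 r <;> by_cases hr : r = q
        · subst hr; simp [hX, hqT, hlq, h.left, hq]
        · simp [hX, hr]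
        · subst hr; simp [hY, hqT, hlq, h.right, hq]
        · simp [hY, hr]
      · rw [if_neg hl, if_neg hl]
  have key : ∀ T, M ∅ = (∏ q ∈ T, if s q ∈ S then (-1 : ℝ) else 1) * M T := by
    intro T
    induction T using Finset.induction_on with
    | empty => simp
    | insert q T hq ih => rw [ih, step q T hq, Finset.prod_insert hq]; ring
  have := key Finset.univ
  simpa [M, X, Y, Function.comp_def] using this

/-- The value of `g ^ m * ω` at complementary index tuples. -/
theorem Complementary.dmul_gpow_eq {m i : ℕ} {ω : DForm n i i} (hω : IsAlt ω) (hsym : IsSym ω)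
    (hc : ∀ (X Y : Fin i → Fin n) (q : Fin i),
      ∑ a, ω (Function.update X q a) (Function.update Y q a) = 0)
    {S : Finset (Fin (m + i))} {u v x y : Fin (m + i) → Fin n} (h : Complementary S u v x y) :
    dmul (gpow n m) ω x y =
      (-1) ^ i * (∏ j, if j ∈ S then 1 else -1) * dmul (gpow n m) ω u v := by
  classical
  obtain ⟨κ, hκ⟩ := exists_dmul_gpow_apply_eq (m := m) hω
  rw [hκ S x y h.eq_iff, hκ S u v h.symm.eq_iff]
  by_cases hS : ∃ σ : Perm (Fin (m + i)), HeadIn S σ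
  · obtain ⟨σ, hσ⟩ := hS
    set s : Fin i → Fin (m + i) := fun q => σ (Fin.natAdd m q) with hs
    have hsS : ∀ j ∉ S, ∃ q, s q = j := fun j hj => hσ.mem_range hj
    have hsi : Function.Injective s := σ.injective.comp (Fin.natAdd_injective i m)
    obtain ⟨c, d, hc0, hcd⟩ := sum_headIn_eq_sum_agreesOff hsi hsS
    have hz : ∀ (X Y : Fin (m + i) → Fin n) (f : Fin i → Fin (m + i)),
        ¬ Function.Injective f → ω (X ∘ f) (Y ∘ f) = 0 := by
      intro X Y f hf
      simp only [Function.Injective, not_forall] at hf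
      obtain ⟨a, b, hab, hne⟩ := hf
      exact hω.apply_left_eq_zero _ hne (by simp [hab])
    have h1 := hcd (fun f => ω (x ∘ f) (y ∘ f))
      (fun f τ => hω.comp_comp (x ∘ f) (y ∘ f) τ) (hz x y)
    have h2 := hcd (fun f => ω (v ∘ f) (u ∘ f))
      (fun f τ => hω.comp_comp (v ∘ f) (u ∘ f) τ) (hz v u)
    rw [sum_agreesOff_eq hω hc h hsS] at h1
    have h3 : (-1 : ℝ) ^ i * (∏ j, if j ∈ S then 1 else -1) = ∏ q, if s q ∈ S then -1 else 1 := by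
      have h4 : (∏ j, if j ∈ S then (1 : ℝ) else -1) = ∏ q, if s q ∈ S then 1 else -1 := by
        rw [← Equiv.prod_comp σ, Fin.prod_univ_add,
          Finset.prod_eq_one fun k _ => if_pos (hσ k), one_mul]
      have h5 : (-1 : ℝ) ^ i = ∏ _q : Fin i, (-1) := by simp
      rw [h4, h5, ← Finset.prod_mul_distrib]
      exact Finset.prod_congr rfl fun q _ => by split_ifs <;> norm_num
    rw [h3]
    simp only [hsym (u ∘ _)]
    apply mul_left_cancel₀ hc0
    linear_combination κ * h1 - κ * (∏ q, if s q ∈ S then (-1 : ℝ) else 1) * h2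
  · have : ∀ σ : Perm (Fin (m + i)), ¬ HeadIn S σ := fun σ hσ => hS ⟨σ, hσ⟩
    simp [if_neg (this _)]

end MiddleDegree

section HodgeStar

variable {n : ℕ}

theorem eps_comp_perm (f : Fin n → Fin n) (σ : Perm (Fin n)) :
    eps (f ∘ σ) = rsign σ * eps f := by
  by_cases h : Function.Bijective f
  · have h' : Function.Bijective (f ∘ σ) := h.comp σ.bijective
    have e : Equiv.ofBijective (f ∘ σ) h' = Equiv.ofBijective f h * σ := by ext; rfl
    rw [eps, dif_pos h', eps, dif_pos h, e]
    change rsign (Equiv.ofBijective f h * σ) = _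
    rw [rsign_mul, mul_comm]
  · have h' : ¬ Function.Bijective (f ∘ σ) := fun h' => h ((σ.bijective_comp f).1 h')
    rw [eps, dif_neg h', eps, dif_neg h, mul_zero]

/-- The Levi-Civita symbol of the concatenation of `u` and `x`. -/
def concatEps {p : ℕ} (e : Fin n ≃ Fin p ⊕ Fin p) (u x : Fin p → Fin n) : ℝ :=
  eps (Sum.elim u x ∘ e)

variable {p : ℕ} (e : Fin n ≃ Fin p ⊕ Fin p)

theorem eps_comp_perm_comp (W : Fin p ⊕ Fin p → Fin n) (ρ : Perm (Fin p ⊕ Fin p)) :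
    eps (W ∘ ρ ∘ e) = ((sign ρ : ℤ) : ℝ) * eps (W ∘ e) := by
  have h : W ∘ ρ ∘ e = (W ∘ e) ∘ e.symm.permCongr ρ := by
    ext j; simp [Equiv.permCongr_apply]
  rw [h, eps_comp_perm, rsign, Perm.sign_permCongr]

theorem concatEps_comp_left (u x : Fin p → Fin n) (σ : Perm (Fin p)) :
    concatEps e (u ∘ σ) x = rsign σ * concatEps e u x := by
  have h := eps_comp_perm_comp e (Sum.elim u x) (Perm.sumCongr σ 1)
  have h' : Sum.elim (u ∘ σ) x = Sum.elim u x ∘ Perm.sumCongr σ 1 := by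
    ext j; cases j <;> simp
  rw [concatEps, h', Function.comp_assoc, h]
  simp [concatEps]

theorem concatEps_comp_right (u x : Fin p → Fin n) (σ : Perm (Fin p)) :
    concatEps e u (x ∘ σ) = rsign σ * concatEps e u x := by
  have h := eps_comp_perm_comp e (Sum.elim u x) (Perm.sumCongr 1 σ)
  have h' : Sum.elim u (x ∘ σ) = Sum.elim u x ∘ Perm.sumCongr 1 σ := by
    ext j; cases j <;> simp
  rw [concatEps, h', Function.comp_assoc, h]
  simp [concatEps]

theorem concatEps_eq_zero {u x : Fin p → Fin n} (h : ¬ Function.Bijective (Sum.elim u x)) :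
    concatEps e u x = 0 :=
  dif_neg fun h' => h ((e.bijective_comp _).1 h')

theorem concatEps_eq_zero_of_not_injective (u : Fin p → Fin n) {x : Fin p → Fin n}
    (h : ¬ Function.Injective x) : concatEps e u x = 0 :=
  concatEps_eq_zero e fun h' => h (h'.injective.comp Sum.inr_injective)

theorem concatEps_mul_self {u x : Fin p → Fin n} (h : Function.Bijective (Sum.elim u x)) :
    concatEps e u x * concatEps e u x = 1 := by
  have h' : Function.Bijective (Sum.elim u x ∘ e) := h.comp e.bijective
  rw [concatEps, eps, dif_pos h']
  exact rsign_mul_self _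

theorem sum_concatEps_mul {Φ : (Fin p → Fin n) → ℝ}
    (hΦ : ∀ u (σ : Perm (Fin p)), Φ (u ∘ σ) = rsign σ * Φ u) {u x : Fin p → Fin n}
    (h : Function.Bijective (Sum.elim u x)) :
    ∑ w, concatEps e w x * Φ w = p.factorial * (concatEps e u x * Φ u) := by
  have hu : Function.Injective u := h.injective.comp Sum.inl_injective
  rw [← Finset.sum_of_injOn (s := Finset.univ) (f := fun _ : Perm (Fin p) => concatEps e u x * Φ u)
    (fun σ : Perm (Fin p) => u ∘ σ)]
  · simp [Fintype.card_perm]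
  · intro σ _ τ _ hστ
    ext j
    exact congrArg Fin.val (hu (congrFun hστ j))
  · intro σ _
    simp
  · intro w _ hw
    rw [concatEps_eq_zero e, zero_mul]
    intro hwx
    apply hw
    have hex : ∀ j, ∃ k, u k = w j := by
      intro j
      obtain ⟨z, hz⟩ := h.surjective (w j)
      cases z with
      | inl k => exact ⟨k, hz⟩
      | inr k => exact absurd (hwx.injective (a₁ := Sum.inr k) (a₂ := Sum.inl j) hz) (by simp)
    choose k hk using hex
    have hki : Function.Injective k := fun a b hab => by
      have h1 : w a = w b := by rw [← hk, ← hk, hab]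
      exact Sum.inl_injective (hwx.injective (a₁ := Sum.inl a) (a₂ := Sum.inl b) h1)
    exact ⟨Equiv.ofBijective k (Finite.injective_iff_bijective.1 hki), by simp, funext hk⟩
  · intro σ _
    rw [concatEps_comp_left, hΦ]
    linear_combination (-concatEps e u x * Φ u) * rsign_mul_self σ

/-- Exchanging the positions off `S` between the two halves multiplies the sign accordingly. -/
theorem Complementary.concatEps_mul {S : Finset (Fin p)} {u v x y : Fin p → Fin n}
    (h : Complementary S u v x y) :
    concatEps e u x * concatEps e v y = ∏ j, if j ∈ S then 1 else -1 := by
  let ρ : Perm (Fin p ⊕ Fin p) := (Equiv.boolProdEquivSum (Fin p)).permCongr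
    (Equiv.prodCongrLeft fun j => if j ∈ S then 1 else Equiv.swap false true)
  have hρ : Sum.elim v y = Sum.elim u x ∘ ρ := by
    ext j
    rcases j with j | j <;> by_cases hj : j ∈ S <;>
      simp [ρ, Equiv.permCongr_apply, h.left, h.right, hj, Equiv.boolProdEquivSum]
  have hs : ((sign ρ : ℤ) : ℝ) = ∏ j, if j ∈ S then 1 else -1 := by
    rw [Perm.sign_permCongr, Perm.sign_prodCongrLeft]
    push_cast
    refine Finset.prod_congr rfl fun j _ => ?_
    split_ifs <;> simp
  have h1 : concatEps e v y = ((sign ρ : ℤ) : ℝ) * concatEps e u x := by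
    rw [concatEps, hρ, Function.comp_assoc, eps_comp_perm_comp]
    rfl
  rw [h1, mul_left_comm, concatEps_mul_self e h.bijective, mul_one, hs]

/-- The Hodge star of middle-degree double forms in terms of concatenated tuples. -/
theorem exists_castD_dstar_apply_eq (hpn : p ≤ n) (h : n - p = p) :
    ∃ e : Fin n ≃ Fin p ⊕ Fin p, ∀ (Θ : DForm n p p) (x y : Fin p → Fin n),
      castD h h (dstar hpn hpn Θ) x y = 1 / (p.factorial * p.factorial : ℝ) *
        ∑ u, concatEps e u x * ∑ v, concatEps e v y * Θ u v := by
  have hn : n = p + (n - p) := by omega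
  let e : Fin n ≃ Fin p ⊕ Fin p := (finCongr hn).trans
    (finSumFinEquiv.symm.trans (Equiv.sumCongr (Equiv.refl _) (finCongr h)))
  have he : ∀ u x : Fin p → Fin n,
      (fun i => Fin.append u (x ∘ Fin.cast h) (Fin.cast hn i)) = Sum.elim u x ∘ e := by
    intro u x
    ext1 i
    obtain ⟨k, rfl⟩ := (finCongr hn).symm.surjective i
    refine Fin.addCases (fun k => ?_) (fun k => ?_) k <;> simp [e]
  refine ⟨e, fun Θ x y => ?_⟩
  simp only [castD, dstar, he, Nat.cast_mul, Finset.mul_sum, concatEps]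
  refine Finset.sum_congr rfl fun u _ => Finset.sum_congr rfl fun v _ => by ring

theorem exists_complementary {x y : Fin p → Fin n} (hn : n = 2 * p) (hx : Function.Injective x)
    (hy : Function.Injective y) :
    ∃ (τ : Perm (Fin p)) (S : Finset (Fin p)) (u v : Fin p → Fin n),
      Complementary S u v x (y ∘ τ) := by
  have hJ : Fintype.card (Fin p) = (Finset.univ.image y).card := by
    rw [Finset.card_image_of_injective _ hy, Finset.card_univ]
  obtain ⟨g, hg⟩ := Set.MapsTo.exists_equiv_extend_of_card_eq hJ
    (s := {j | x j ∈ Finset.univ.image y}) (f := x) (fun j hj => hj) hx.injOn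
  have hgy : ∀ j, ∃ k, y k = g j := fun j => by
    obtain ⟨k, _, hk⟩ := Finset.mem_image.1 (g j).2
    exact ⟨k, hk⟩
  choose t ht using hgy
  have hti : Function.Injective t := fun a b hab => g.injective <| Subtype.ext <| by
    rw [← ht, ← ht, hab]
  let τ : Perm (Fin p) := Equiv.ofBijective t (Finite.injective_iff_bijective.1 hti)
  have hτ : ∀ j, y (τ j) = g j := ht
  let S : Finset (Fin p) := Finset.univ.filter fun j => x j ∈ Finset.univ.image y
  have hS : ∀ j, j ∈ S ↔ x j ∈ Finset.univ.image y := by simp [S]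
  have hSy : ∀ j ∈ S, y (τ j) = x j := fun j hj => by rw [hτ, hg j ((hS j).1 hj)]
  have hI : Fintype.card (Fin p) = ((Finset.univ.image x)ᶜ).card := by
    rw [Finset.card_compl, Finset.card_image_of_injective _ hx, Finset.card_univ,
      Fintype.card_fin, Fintype.card_fin]
    omega
  obtain ⟨w, hw⟩ := Set.MapsTo.exists_equiv_extend_of_card_eq hI (s := {j | j ∉ S}) (f := y ∘ τ)
    (by
      intro j hj
      simp only [Finset.coe_compl, Set.mem_compl_iff, Finset.mem_coe, Finset.mem_image,
        Finset.mem_univ, true_and, not_exists, Function.comp_apply]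
      intro k hk
      have hkS : k ∈ S := (hS k).2 (by rw [hk]; simp)
      have := τ.injective (hy ((hSy k hkS).trans hk))
      exact hj (this ▸ hkS))
    (hy.comp τ.injective).injOn
  refine ⟨τ, S, fun j => w j, fun j => if j ∈ S then w j else x j, ?_, fun j => ?_, fun j => rfl⟩
  · rw [Fintype.bijective_iff_injective_and_card]
    refine ⟨?_, by simp [hn, two_mul]⟩
    refine Function.Injective.sumElim (Subtype.val_injective.comp w.injective) hx fun a b hab => ?_
    have := (w a).2
    rw [hab] at this
    simp at this
  · split_ifs with hj
    · exact hSy j hj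
    · exact (hw j hj).symm

theorem Complementary.castD_dstar_apply (hpn : p ≤ n) (h : n - p = p) {Θ : DForm n p p}
    (hΘ : IsAlt Θ) {S : Finset (Fin p)} {u v x y : Fin p → Fin n} (hc : Complementary S u v x y) :
    castD h h (dstar hpn hpn Θ) x y = (∏ j, if j ∈ S then 1 else -1) * Θ u v := by
  obtain ⟨e, he⟩ := exists_castD_dstar_apply_eq hpn h
  have hbij : Function.Bijective (Sum.elim v y) := by
    by_contra hnot
    have h0 := hc.concatEps_mul e
    rw [concatEps_eq_zero e hnot, mul_zero] at h0
    exact Finset.prod_ne_zero_iff.2 (fun j _ => by split_ifs <;> norm_num) h0.symm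
  have h1 : ∀ w, ∑ z, concatEps e z y * Θ w z = p.factorial * (concatEps e v y * Θ w v) :=
    fun w => sum_concatEps_mul e (fun z σ => hΘ.2 σ w z) hbij
  have h2 := sum_concatEps_mul e (Φ := fun w => Θ w v) (fun w σ => hΘ.1 σ w v) hc.bijective
  have hp : (p.factorial : ℝ) ≠ 0 := by positivity
  have h3 : ∑ w, concatEps e w x * (p.factorial * (concatEps e v y * Θ w v)) =
      p.factorial * concatEps e v y * ∑ w, concatEps e w x * Θ w v := by
    rw [Finset.mul_sum]
    exact Finset.sum_congr rfl fun w _ => by ring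
  simp only [he, h1]
  rw [h3, h2, ← hc.concatEps_mul e]
  field_simp

theorem castD_dstar_sum (hpn : p ≤ n) (h : n - p = p) {ι : Type*} (s : Finset ι)
    (Θ : ι → DForm n p p) :
    castD h h (dstar hpn hpn (∑ k ∈ s, Θ k)) = ∑ k ∈ s, castD h h (dstar hpn hpn (Θ k)) := by
  obtain ⟨e, he⟩ := exists_castD_dstar_apply_eq hpn h
  ext x y
  simp only [Finset.sum_apply, he, Finset.mul_sum]
  conv_rhs => rw [Finset.sum_comm]
  refine Finset.sum_congr rfl fun u _ => ?_
  rw [Finset.sum_comm]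

/-- The Hodge star acts on `g ^ m * ω`, for `ω` effective and symmetric of bidegree `(i, i)` in
dimension `2 (m + i)`, as multiplication by `(-1) ^ i`. -/
theorem castD_dstar_dmul_gpow {m i : ℕ} (hmi : m + i = p) (hn : n = 2 * p) (hpn : p ≤ n)
    (h : n - p = p) {ω : DForm n i i} (hω : IsAlt ω) (hsym : IsSym ω)
    (hc : ∀ (X Y : Fin i → Fin n) (q : Fin i),
      ∑ a, ω (Function.update X q a) (Function.update Y q a) = 0) :
    castD h h (dstar hpn hpn (castD hmi hmi (dmul (gpow n m) ω))) =
      (-1 : ℝ) ^ i • castD hmi hmi (dmul (gpow n m) ω) := by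
  subst hmi
  change castD h h (dstar hpn hpn (dmul (gpow n m) ω)) = (-1 : ℝ) ^ i • dmul (gpow n m) ω
  have hΘ := isAlt_dmul (gpow n m) ω
  obtain ⟨e, he⟩ := exists_castD_dstar_apply_eq hpn h
  ext x y
  simp only [Pi.smul_apply, smul_eq_mul]
  by_cases hx : Function.Injective x
  · by_cases hy : Function.Injective y
    · obtain ⟨τ, S, u, v, hcomp⟩ := exists_complementary hn hx hy
      have h1 := hcomp.castD_dstar_apply hpn h hΘ
      have h2 := hcomp.dmul_gpow_eq hω hsym hc
      have h3 : castD h h (dstar hpn hpn (dmul (gpow n m) ω)) x (y ∘ τ) =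
          rsign τ * castD h h (dstar hpn hpn (dmul (gpow n m) ω)) x y := by
        simp only [he, concatEps_comp_right, Finset.mul_sum]
        refine Finset.sum_congr rfl fun _ _ => Finset.sum_congr rfl fun _ _ => by ring
      have h4 : ((-1 : ℝ) ^ i) * (-1) ^ i = 1 := by rw [← mul_pow]; simp
      rw [h3] at h1
      rw [hΘ.2] at h2
      have h5 := rsign_mul_self τ
      have h6 : rsign τ ≠ 0 := fun h0 => by simp [h0] at h5
      apply mul_left_cancel₀ h6
      rw [h1, mul_left_comm, h2, ← mul_assoc, ← mul_assoc, h4, one_mul]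
    · have hy' := hy
      simp only [Function.Injective, not_forall] at hy'
      obtain ⟨a, b, hab, hne⟩ := hy'
      rw [he, hΘ.apply_right_eq_zero _ hne hab]
      simp [concatEps_eq_zero_of_not_injective e _ hy]
  · have hx' := hx
    simp only [Function.Injective, not_forall] at hx'
    obtain ⟨a, b, hab, hne⟩ := hx'
    rw [he, hΘ.apply_left_eq_zero _ hne hab]
    simp [concatEps_eq_zero_of_not_injective e _ hx]

end HodgeStar

end StarDecomposition

/-- Labbi's formula for the double Hodge star on curvature structures in the middle
bidegree.  Let `n = 2p` and let `Ω = Σ_{i=0}^p g^{p-i}·ω_i ∈ C₁^p` be the orthogonal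
decomposition of a symmetric double form satisfying the first Bianchi identity, with
each `ω_i ∈ E^{i,i}` effective (and symmetric, satisfying the first Bianchi
identity).  Then `*Ω = Σ_{i=0}^p (-1)^i g^{p-i}·ω_i`.  In particular, for an
algebraic curvature tensor `R = ω₂ + g ω₁ + g² ω₀` in dimension `n = 2p`, taking
`Ω = g^{p-2} R` gives `*(g^{p-2}R) = g^{p-2}ω₂ - g^{p-1}ω₁ + g^p ω₀`. -/
theorem star_curvature_decomposition (n p : ℕ) (hp : 1 ≤ p) (hn : n = 2 * p)
    (ω : (i : ℕ) → DForm n i i)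
    (halt : ∀ i, IsAlt (ω i)) (hsym : ∀ i, IsSym (ω i))
    (heff : ∀ i : ℕ, contr (ω (i + 1)) = 0)
    (hbia : ∀ i : ℕ, FirstBianchi (n := n) (p := i + 1) (q := i) (ω (i + 1))) :
    ∀ Ω : DForm n p p,
      Ω = (∑ i : Fin (p + 1),
            castD (show (p - (i : ℕ)) + (i : ℕ) = p by have := i.isLt; omega)
                  (show (p - (i : ℕ)) + (i : ℕ) = p by have := i.isLt; omega)
              (dmul (gpow n (p - (i : ℕ))) (ω (i : ℕ)))) →
      castD (show n - p = p by omega) (show n - p = p by omega)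
          (dstar (show p ≤ n by omega) (show p ≤ n by omega) Ω)
        = ∑ i : Fin (p + 1),
            ((-1 : ℝ) ^ (i : ℕ)) •
              castD (show (p - (i : ℕ)) + (i : ℕ) = p by have := i.isLt; omega)
                    (show (p - (i : ℕ)) + (i : ℕ) = p by have := i.isLt; omega)
                (dmul (gpow n (p - (i : ℕ))) (ω (i : ℕ))) := by
  rintro Ω rfl
  rw [castD_dstar_sum]
  refine Finset.sum_congr rfl fun k _ => ?_
  refine castD_dstar_dmul_gpow _ hn _ _ (halt _) (hsym _) ?_
  generalize (k : ℕ) = i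
  cases i with
  | zero => exact fun _ _ q => q.elim0
  | succ i => exact sum_update_eq_zero (halt _) (heff i)

end
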